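/- There exist universal constants C₀, c₀, C > 0 such that the following holds for all positive integers k ≤ n and all m ≥ C₀·k·log(en/k). If A ∈ ℝ^{m×n} is a standard Gaussian random matrix, then with probability at least 1 − exp(−c₀·m): for every x ∈ ℝ^n and every x♯ ∈ ℝ^n satisfying |A x♯| = |A x| entrywise and ‖x♯‖₁ ≤ ‖z‖₁ for all z ∈ ℝ^n with |A z| = |A x| (that is, x♯ is a minimizer of the ℓ₁ norm subject to the phaseless constraint), one has dist₁(x♯, x) ≤ C·σ_k(x)₁ and dist(x♯, x) ≤ C·σ_k(x)₁/√k. -/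

import Mathlib

open MeasureTheory ProbabilityTheory Real Finset

/-- The `ℓ_q` (quasi-)norm `(∑ i, ‖x i‖^q)^{1/q}` of a vector with entries in `𝕜 ∈ {ℝ, ℂ}`. -/
noncomputable def lpNorm {ι : Type*} [Fintype ι] {𝕜 : Type*} [RCLike 𝕜] (q : ℝ) (x : ι → 𝕜) : ℝ :=
  (∑ i, ‖x i‖ ^ q) ^ (1 / q)

open Classical in
/-- The number of nonzero entries of a vector. -/
noncomputable def l0Norm {ι : Type*} [Fintype ι] {𝕜 : Type*} [RCLike 𝕜] (x : ι → 𝕜) : ℕ :=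
  (Finset.univ.filter fun i => x i ≠ 0).card

/-- The phase distance `dist_q(x,y) = inf_{|c|=1} ‖x - c • y‖_q`. -/
noncomputable def phaseDist {ι : Type*} [Fintype ι] {𝕜 : Type*} [RCLike 𝕜] (q : ℝ)
    (x y : ι → 𝕜) : ℝ :=
  sInf {d | ∃ c : 𝕜, ‖c‖ = 1 ∧ d = lpNorm q (fun i => x i - c * y i)}

/-- The best `k`-term approximation error `σ_k(x)_q = inf {‖x - z‖_q : ‖z‖₀ ≤ k}`. -/
noncomputable def sigmaK {ι : Type*} [Fintype ι] {𝕜 : Type*} [RCLike 𝕜] (k : ℕ) (q : ℝ)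
    (x : ι → 𝕜) : ℝ :=
  sInf {d | ∃ z : ι → 𝕜, l0Norm z ≤ k ∧ d = lpNorm q (fun i => x i - z i)}

/-- The entrywise modulus `|Ax|` of the matrix-vector product `Ax`. -/
noncomputable def absMv {m n : ℕ} {𝕜 : Type*} [RCLike 𝕜] (A : Fin m → Fin n → 𝕜)
    (x : Fin n → 𝕜) : Fin m → ℝ :=
  fun i => ‖∑ j, A i j * x j‖

/-- `A` satisfies the phaseless bi-Lipschitz condition on `X` with constants `L, U`:
`L·dist(x,y) ≤ ‖|Ax| - |Ay|‖₂ ≤ U·dist(x,y)` for all `x, y ∈ X`. -/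
def PhaselessBiLip {m n : ℕ} {𝕜 : Type*} [RCLike 𝕜] (A : Fin m → Fin n → 𝕜)
    (X : Set (Fin n → 𝕜)) (L U : ℝ) : Prop :=
  ∀ x ∈ X, ∀ y ∈ X,
    L * phaseDist 2 x y ≤ lpNorm 2 (fun i => absMv A x i - absMv A y i) ∧
    lpNorm 2 (fun i => absMv A x i - absMv A y i) ≤ U * phaseDist 2 x y

/-- The law of a standard Gaussian random matrix `A ∈ ℝ^{m×n}`: the product over the `m·n`
entries of the real Gaussian measure with mean `0` and variance `1`. -/
noncomputable def gaussMatrixReal (m n : ℕ) : Measure (Fin m → Fin n → ℝ) :=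
  Measure.pi fun _ : Fin m => Measure.pi fun _ : Fin n => gaussianReal 0 1

section GaussianLemmas

lemma lintegral_pi_prod {ι : Type*} [Fintype ι] {E : ι → Type*} [∀ i, MeasurableSpace (E i)]
    (μ : ∀ i, Measure (E i)) [∀ i, IsProbabilityMeasure (μ i)] (f : ∀ i, E i → ENNReal)
    (hf : ∀ i, Measurable (f i)) :
    ∫⁻ x, ∏ i, f i (x i) ∂Measure.pi μ = ∏ i, ∫⁻ x, f i x ∂μ i := by
  rw [lintegral_prod_eq_prod_lintegral_of_indepFun (μ := Measure.pi μ) Finset.univ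
    (fun i (x : ∀ i, E i) => f i (x i))
    (iIndepFun_pi fun i => (hf i).aemeasurable) (fun i => (hf i).comp (measurable_pi_apply i))]
  refine Finset.prod_congr rfl fun i _ => ?_
  exact (measurePreserving_eval μ i).lintegral_comp (hf i)

lemma map_linearForm_gaussian {n : ℕ} (v : Fin n → ℝ) :
    (Measure.pi fun _ : Fin n => gaussianReal 0 1).map (fun a => ∑ j, a j * v j) =
      gaussianReal 0 (∑ j, v j ^ 2).toNNReal := by
  have hm : Measurable (fun a : Fin n → ℝ => ∑ j, a j * v j) := by fun_prop
  have := Measure.isProbabilityMeasure_map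
    (μ := Measure.pi fun _ : Fin n => gaussianReal 0 1) hm.aemeasurable
  apply Measure.ext_of_charFun
  ext t
  rw [charFun_apply_real, integral_map hm.aemeasurable (by fun_prop), charFun_gaussianReal]
  have h1 : ∀ a : Fin n → ℝ, Complex.exp (t * ((∑ j, a j * v j : ℝ) : ℂ) * Complex.I) =
      ∏ j, Complex.exp (((t * v j : ℝ) : ℂ) * (a j : ℂ) * Complex.I) := by
    intro a
    rw [← Complex.exp_sum]
    congr 1
    push_cast
    rw [Finset.mul_sum, Finset.sum_mul]
    refine Finset.sum_congr rfl fun j _ => ?_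
    ring
  simp_rw [h1]
  rw [integral_fintype_prod_eq_prod (μ := fun _ : Fin n => gaussianReal 0 1)
    (fun j (x : ℝ) => Complex.exp (((t * v j : ℝ) : ℂ) * (x : ℂ) * Complex.I))]
  simp_rw [← charFun_apply_real, charFun_gaussianReal]
  rw [← Complex.exp_sum]
  congr 1
  have h2 : (((∑ j, v j ^ 2).toNNReal : ℝ) : ℂ) = ∑ j, (v j : ℂ) ^ 2 := by
    rw [Real.coe_toNNReal _ (Finset.sum_nonneg fun j _ => sq_nonneg _)]
    push_cast
    rfl
  simp only [Complex.ofReal_zero, mul_zero, zero_mul, zero_sub]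
  rw [h2, Finset.sum_mul, Finset.sum_div, ← Finset.sum_neg_distrib]
  refine Finset.sum_congr rfl fun j _ => ?_
  push_cast
  ring

lemma lintegral_linearForm_gaussian {n : ℕ} (v : Fin n → ℝ) {F : ℝ → ENNReal}
    (hF : Measurable F) :
    ∫⁻ a, F (∑ j, a j * v j) ∂(Measure.pi fun _ : Fin n => gaussianReal 0 1) =
      ∫⁻ x, F x ∂gaussianReal 0 (∑ j, v j ^ 2).toNNReal := by
  rw [← map_linearForm_gaussian, lintegral_map hF (by fun_prop)]

instance (m n : ℕ) : IsProbabilityMeasure (gaussMatrixReal m n) := by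
  unfold gaussMatrixReal; infer_instance

lemma gaussMatrixReal_eq_map (m n : ℕ) :
    gaussMatrixReal m n =
      (Measure.pi fun _ : Fin m × Fin n => gaussianReal 0 1).map
        (fun a i j => a (i, j)) := by
  have h := Measure.infinitePi_map_curry (ι := Fin m) (κ := Fin n) (X := ℝ)
    (fun _ _ => gaussianReal 0 1)
  simp only [Measure.infinitePi_eq_pi] at h
  rw [gaussMatrixReal, ← h]
  rfl

lemma lintegral_gaussMatrix_transpose {m n : ℕ} {F : (Fin n → Fin m → ℝ) → ENNReal}
    (hF : Measurable F) :
    ∫⁻ A, F (fun j i => A i j) ∂gaussMatrixReal m n = ∫⁻ B, F B ∂gaussMatrixReal n m := by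
  have h := measurePreserving_piCongrLeft (fun _ : Fin n × Fin m => gaussianReal 0 1)
    (Equiv.prodComm (Fin m) (Fin n))
  rw [gaussMatrixReal_eq_map m n, gaussMatrixReal_eq_map n m,
    lintegral_map (by fun_prop) (by fun_prop), lintegral_map hF (by fun_prop), ← h.map_eq,
    lintegral_map (by fun_prop) h.measurable]
  rfl

lemma lintegral_prod_rows {m n : ℕ} (v : Fin n → ℝ) {F : Fin m → ℝ → ENNReal}
    (hF : ∀ i, Measurable (F i)) :
    ∫⁻ A, ∏ i, F i (∑ j, A i j * v j) ∂gaussMatrixReal m n =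
      ∏ i, ∫⁻ x, F i x ∂gaussianReal 0 (∑ j, v j ^ 2).toNNReal := by
  rw [gaussMatrixReal, lintegral_pi_prod (fun _ : Fin m => Measure.pi fun _ : Fin n => gaussianReal 0 1)
    (fun i (a : Fin n → ℝ) => F i (∑ j, a j * v j))
    (fun i => (hF i).comp (by fun_prop))]
  exact Finset.prod_congr rfl fun i _ => lintegral_linearForm_gaussian v (hF i)

lemma lintegral_prod_columns {m n : ℕ} (w : Fin m → ℝ) {F : Fin n → ℝ → ENNReal}
    (hF : ∀ j, Measurable (F j)) :
    ∫⁻ A, ∏ j, F j (∑ i, A i j * w i) ∂gaussMatrixReal m n =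
      ∏ j, ∫⁻ x, F j x ∂gaussianReal 0 (∑ i, w i ^ 2).toNNReal := by
  rw [← lintegral_prod_rows w hF]
  exact lintegral_gaussMatrix_transpose (F := fun B => ∏ j, F j (∑ i, B j i * w i))
    (Finset.measurable_prod _ fun j _ => (hF j).comp (by fun_prop))

lemma lintegral_exp_neg_mul_abs {l : ℝ} (hl : 0 < l) :
    ∫⁻ x : ℝ, ENNReal.ofReal (exp (-l * |x|)) = ENNReal.ofReal (2 / l) := by
  have h : ∫ x : ℝ, exp (-l * |x|) = 2 / l := by
    rw [integral_comp_abs (f := fun x => exp (-l * x)),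
      integral_exp_mul_Ioi (by linarith) 0]
    simp
    field_simp
  have hi : Integrable (fun x : ℝ => exp (-l * |x|)) :=
    not_imp_comm.1 integral_undef (by rw [h]; positivity)
  rw [← ofReal_integral_eq_lintegral_ofReal hi (ae_of_all _ fun x => (exp_pos _).le), h]

lemma lintegral_exp_neg_abs_gaussian_le {v : NNReal} (hv : 1 / 4 ≤ v) {l : ℝ} (hl : 0 < l) :
    ∫⁻ x, ENNReal.ofReal (exp (-l * |x|)) ∂gaussianReal 0 v ≤ ENNReal.ofReal (2 / l) := by
  have hv0 : v ≠ 0 := by rintro rfl; norm_num at hv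
  rw [gaussianReal_of_var_ne_zero _ hv0,
    lintegral_withDensity_eq_lintegral_mul _ (measurable_gaussianPDF _ _) (by fun_prop),
    ← lintegral_exp_neg_mul_abs hl]
  refine lintegral_mono fun x => ?_
  simp only [Pi.mul_apply, gaussianPDF]
  refine mul_le_of_le_one_left zero_le (ENNReal.ofReal_le_one.2 ?_)
  rw [gaussianPDFReal]
  have hv' : (1 / 4 : ℝ) ≤ v := by exact_mod_cast hv
  have h1 : 1 ≤ √(2 * π * v) := by
    rw [Real.one_le_sqrt]
    nlinarith [Real.pi_gt_three]
  refine mul_le_one₀ (inv_le_one_of_one_le₀ h1) (exp_pos _).le (exp_le_one_iff.2 ?_)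
  have : 0 ≤ (x - 0) ^ 2 / (2 * (v : ℝ)) := by positivity
  rw [neg_div]; linarith

lemma lintegral_exp_sq_gaussian :
    ∫⁻ x, ENNReal.ofReal (exp (3 / 8 * x ^ 2)) ∂gaussianReal 0 1 = 2 := by
  rw [gaussianReal_of_var_ne_zero _ one_ne_zero,
    lintegral_withDensity_eq_lintegral_mul _ (measurable_gaussianPDF _ _) (by fun_prop)]
  have : ∀ x, (gaussianPDF 0 1 * fun x => ENNReal.ofReal (exp (3 / 8 * x ^ 2))) x =
      2 * gaussianPDF 0 4 x := by
    intro x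
    simp only [Pi.mul_apply, gaussianPDF]
    rw [← ENNReal.ofReal_mul (gaussianPDFReal_nonneg _ _ _),
      show (2 : ENNReal) = ENNReal.ofReal 2 by simp, ← ENNReal.ofReal_mul (by norm_num)]
    congr 1
    simp only [gaussianPDFReal]
    have h4 : √(2 * π * ((4 : NNReal) : ℝ)) = 2 * √(2 * π) := by
      rw [show 2 * π * ((4 : NNReal) : ℝ) = 2 ^ 2 * (2 * π) by push_cast; ring,
        Real.sqrt_mul (by norm_num), Real.sqrt_sq (by norm_num)]
    rw [h4, mul_assoc, ← exp_add]
    have hp : 0 < √(2 * π) := by positivity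
    push_cast
    rw [mul_one, show -(x - 0) ^ 2 / (2 * 1) + 3 / 8 * x ^ 2 = -(x - 0) ^ 2 / (2 * 4) by ring]
    field_simp
  simp_rw [this]
  rw [lintegral_const_mul _ (measurable_gaussianPDF _ _),
    lintegral_gaussianPDF_eq_one _ (by norm_num), mul_one]

end GaussianLemmas

section TailBounds

/-- The square of `y` if `|y|` exceeds the threshold `τ`, and `0` otherwise. -/
noncomputable def largeSq (τ y : ℝ) : ℝ := if τ < |y| then y ^ 2 else 0

lemma measurable_largeSq (τ : ℝ) : Measurable (largeSq τ) :=
  Measurable.ite (measurableSet_lt measurable_const (by fun_prop)) (by fun_prop) measurable_const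

lemma measure_ge_le_of_lintegral_exp {Ω : Type*} [MeasurableSpace Ω] {μ : Measure Ω}
    {f : Ω → ℝ} (hf : Measurable f) (b : ℝ) {K : ℝ}
    (hK : ∫⁻ x, ENNReal.ofReal (exp (f x)) ∂μ ≤ ENNReal.ofReal K) :
    μ {x | b ≤ f x} ≤ ENNReal.ofReal (exp (-b) * K) := by
  have h1 : {x | b ≤ f x} = {x | ENNReal.ofReal (exp b) ≤ ENNReal.ofReal (exp (f x))} := by
    ext x
    simp [ENNReal.ofReal_le_ofReal_iff (exp_pos _).le]
  rw [h1]
  refine (meas_ge_le_lintegral_div (by fun_prop) (by simp [exp_pos]) (by simp)).trans ?_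
  rw [ENNReal.div_eq_inv_mul, ENNReal.ofReal_mul (exp_pos _).le, exp_neg,
    ENNReal.ofReal_inv_of_pos (exp_pos _)]
  gcongr

lemma exp_largeSq_le {τ : ℝ} (hτ : 0 ≤ τ) (y : ℝ) :
    exp (largeSq τ y / 4) ≤ 1 + exp (-(τ ^ 2 / 8)) * exp (3 / 8 * y ^ 2) := by
  unfold largeSq
  split_ifs with h
  · rw [← exp_add]
    have h2 : τ ^ 2 ≤ y ^ 2 := by rw [← sq_abs y]; gcongr
    have : exp (y ^ 2 / 4) ≤ exp (-(τ ^ 2 / 8) + 3 / 8 * y ^ 2) := exp_le_exp.2 (by linarith)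
    linarith
  · simp only [zero_div, exp_zero]
    have := mul_pos (exp_pos (-(τ ^ 2 / 8))) (exp_pos (3 / 8 * y ^ 2))
    linarith

lemma lintegral_exp_largeSq_le {τ : ℝ} (hτ : 0 ≤ τ) :
    ∫⁻ y, ENNReal.ofReal (exp (largeSq τ y / 4)) ∂gaussianReal 0 1 ≤
      ENNReal.ofReal (exp (2 * exp (-(τ ^ 2 / 8)))) := by
  calc ∫⁻ y, ENNReal.ofReal (exp (largeSq τ y / 4)) ∂gaussianReal 0 1
      ≤ ∫⁻ y, (1 + ENNReal.ofReal (exp (-(τ ^ 2 / 8))) * ENNReal.ofReal (exp (3 / 8 * y ^ 2)))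
          ∂gaussianReal 0 1 := by
        refine lintegral_mono fun y => ?_
        rw [← ENNReal.ofReal_mul (exp_pos _).le, ← ENNReal.ofReal_one,
          ← ENNReal.ofReal_add zero_le_one (by positivity)]
        exact ENNReal.ofReal_le_ofReal (exp_largeSq_le hτ y)
    _ = ENNReal.ofReal (1 + 2 * exp (-(τ ^ 2 / 8))) := by
        rw [lintegral_add_left measurable_const, lintegral_const_mul _ (by fun_prop),
          lintegral_exp_sq_gaussian, lintegral_const, measure_univ, mul_one,
          ENNReal.ofReal_add zero_le_one (by positivity), ENNReal.ofReal_mul (by norm_num),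
          mul_comm]
        simp
    _ ≤ _ := ENNReal.ofReal_le_ofReal (by
        have := add_one_le_exp (2 * exp (-(τ ^ 2 / 8)))
        linarith)

lemma gaussMatrix_largeSq_tail {m n : ℕ} {w : Fin m → ℝ} (hw : ∑ i, w i ^ 2 = 1) {τ : ℝ}
    (hτ : 0 ≤ τ) (b : ℝ) :
    gaussMatrixReal m n {A | b ≤ ∑ j, largeSq τ (∑ i, A i j * w i)} ≤
      ENNReal.ofReal (exp (-(b / 4)) * exp (n * (2 * exp (-(τ ^ 2 / 8))))) := by
  have hms := measurable_largeSq τ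
  have h := measure_ge_le_of_lintegral_exp (μ := gaussMatrixReal m n)
    (f := fun A => ∑ j, largeSq τ (∑ i, A i j * w i) / 4)
    (Finset.measurable_sum _ fun j _ => (hms.comp (by fun_prop)).div_const _) (b / 4)
    (K := exp (n * (2 * exp (-(τ ^ 2 / 8))))) ?_
  · refine le_trans (measure_mono fun A hA => ?_) h
    simp only [Set.mem_ofPred_eq, ← Finset.sum_div] at hA ⊢
    linarith
  · simp_rw [exp_sum, ENNReal.ofReal_prod_of_nonneg (fun i _ => (exp_pos _).le)]
    rw [lintegral_prod_columns w (F := fun _ y => ENNReal.ofReal (exp (largeSq τ y / 4)))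
      (fun _ => by fun_prop), hw, Real.toNNReal_one]
    refine (Finset.prod_le_prod' fun j _ => lintegral_exp_largeSq_le hτ).trans ?_
    simp only [Finset.prod_const, Finset.card_univ, Fintype.card_fin]
    rw [← ENNReal.ofReal_pow (exp_pos _).le, ← exp_nat_mul]

lemma gaussMatrix_small_ball {m n : ℕ} {u : Fin n → ℝ} (hu : 1 / 4 ≤ ∑ j, u j ^ 2)
    (T : Finset (Fin m)) {l : ℝ} (hl : 0 < l) (b : ℝ) :
    gaussMatrixReal m n {A | ∑ i ∈ T, |∑ j, A i j * u j| ≤ b} ≤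
      ENNReal.ofReal (exp (l * b) * (2 / l) ^ T.card) := by
  classical
  have h := measure_ge_le_of_lintegral_exp (μ := gaussMatrixReal m n)
    (f := fun A => ∑ i ∈ T, -l * |∑ j, A i j * u j|) (by fun_prop) (-(l * b))
    (K := (2 / l) ^ T.card) ?_
  · rw [neg_neg] at h
    refine le_trans (measure_mono fun A hA => ?_) h
    simp only [Set.mem_ofPred_eq, ← Finset.mul_sum] at hA ⊢
    nlinarith
  · have h1 : ∀ A : Fin m → Fin n → ℝ,
        ENNReal.ofReal (exp (∑ i ∈ T, -l * |∑ j, A i j * u j|)) =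
        ∏ i, (if i ∈ T then ENNReal.ofReal (exp (-l * |∑ j, A i j * u j|)) else 1) := by
      intro A
      rw [exp_sum, ENNReal.ofReal_prod_of_nonneg (fun i _ => (exp_pos _).le),
        Finset.prod_ite_mem, Finset.univ_inter]
    simp_rw [h1]
    rw [lintegral_prod_rows u
      (F := fun i y => if i ∈ T then ENNReal.ofReal (exp (-l * |y|)) else 1)
      (fun i => by split_ifs <;> fun_prop)]
    calc _ ≤ ∏ i : Fin m, (if i ∈ T then ENNReal.ofReal (2 / l) else 1) := by
          refine Finset.prod_le_prod' fun i _ => ?_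
          split_ifs
          · refine lintegral_exp_neg_abs_gaussian_le ?_ hl
            rw [← NNReal.coe_le_coe, Real.coe_toNNReal _ (by linarith)]
            push_cast
            exact hu
          · simp
      _ = _ := by
          rw [Finset.prod_ite_mem, Finset.univ_inter, Finset.prod_const,
            ENNReal.ofReal_pow (by positivity)]

end TailBounds

section IntegerPoints

/-- The integer vectors of `ℓ₁`-norm at most `K`. -/
noncomputable def intBall (n K : ℕ) : Finset (Fin n → ℤ) :=
  (Fintype.piFinset fun _ => Finset.Icc (-(K : ℤ)) K).filter fun z => ∑ j, (z j).natAbs ≤ K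

lemma mem_intBall {n K : ℕ} {z : Fin n → ℤ} : z ∈ intBall n K ↔ ∑ j, (z j).natAbs ≤ K := by
  simp only [intBall, Finset.mem_filter, Fintype.mem_piFinset, Finset.mem_Icc, and_iff_right_iff_imp]
  intro h j
  have := (Finset.single_le_sum (f := fun j => (z j).natAbs) (fun _ _ => Nat.zero_le _)
    (Finset.mem_univ j)).trans h
  omega

lemma sum_pow_natAbs_le {t : ℝ} (h0 : 0 ≤ t) (h1 : t ≤ 1 / 2) (K : ℕ) :
    ∑ a ∈ Finset.Icc (-(K : ℤ)) K, t ^ a.natAbs ≤ exp (4 * t) := by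
  have key : ∀ K : ℕ, ∑ a ∈ Finset.Icc (-(K : ℤ)) K, t ^ a.natAbs + 4 * t ^ (K + 1) ≤ 1 + 4 * t := by
    intro K
    induction K with
    | zero => simp
    | succ K ih =>
      have hset : Finset.Icc (-((K + 1 : ℕ) : ℤ)) ((K + 1 : ℕ) : ℤ) =
          insert (-((K + 1 : ℕ) : ℤ)) (insert ((K + 1 : ℕ) : ℤ) (Finset.Icc (-(K : ℤ)) K)) := by
        ext a
        simp only [Finset.mem_Icc, Finset.mem_insert]
        omega
      rw [hset, Finset.sum_insert, Finset.sum_insert]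
      · simp only [Int.natAbs_neg, Int.natAbs_natCast]
        have : t ^ (K + 1 + 1) ≤ t ^ (K + 1) * (1 / 2) := by rw [pow_succ]; gcongr
        linarith
      · simp only [Finset.mem_Icc]; omega
      · simp only [Finset.mem_Icc, Finset.mem_insert]; omega
  have := key K
  have h2 : 0 ≤ t ^ (K + 1) := by positivity
  have h3 := add_one_le_exp (4 * t)
  linarith

lemma card_intBall_le {t : ℝ} (h0 : 0 < t) (h1 : t ≤ 1 / 2) (n K : ℕ) :
    ((intBall n K).card : ℝ) ≤ (1 / t) ^ K * exp (n * (4 * t)) := by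
  have h2 : ((intBall n K).card : ℝ) * t ^ K ≤ exp (n * (4 * t)) := by
    calc ((intBall n K).card : ℝ) * t ^ K = ∑ z ∈ intBall n K, t ^ K := by
          rw [Finset.sum_const, nsmul_eq_mul]
      _ ≤ ∑ z ∈ intBall n K, ∏ j, t ^ (z j).natAbs := by
          refine Finset.sum_le_sum fun z hz => ?_
          rw [Finset.prod_pow_eq_pow_sum]
          exact pow_le_pow_of_le_one h0.le (by linarith) (mem_intBall.1 hz)
      _ ≤ ∑ z ∈ Fintype.piFinset fun _ : Fin n => Finset.Icc (-(K : ℤ)) K,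
            ∏ j, t ^ (z j).natAbs :=
          Finset.sum_le_sum_of_subset_of_nonneg (Finset.filter_subset _ _)
            fun z _ _ => Finset.prod_nonneg fun j _ => pow_nonneg h0.le _
      _ = ∏ j : Fin n, ∑ a ∈ Finset.Icc (-(K : ℤ)) K, t ^ a.natAbs :=
          Finset.sum_prod_piFinset (Finset.Icc (-(K : ℤ)) K)
            fun (_ : Fin n) (a : ℤ) => t ^ a.natAbs
      _ ≤ ∏ _j : Fin n, exp (4 * t) :=
          Finset.prod_le_prod (fun j _ => Finset.sum_nonneg fun a _ => pow_nonneg h0.le _)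
            fun j _ => sum_pow_natAbs_le h0.le h1 K
      _ = exp (n * (4 * t)) := by simp [← exp_nat_mul]
  rw [div_pow, one_pow, one_div_mul_eq_div, le_div_iff₀ (by positivity)]
  exact h2

end IntegerPoints

section NullSpace

lemma exists_int_toward_zero {η : ℝ} (hη : 0 < η) (x : ℝ) :
    ∃ z : ℤ, |x - η * z| ≤ η ∧ |x - η * z| ≤ |x| ∧ η * z.natAbs ≤ |x| := by
  have key : ∀ y : ℝ, 0 ≤ y → ∃ z : ℤ, |y - η * z| ≤ η ∧ |y - η * z| ≤ |y| ∧
      η * z.natAbs ≤ |y| := by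
    intro y hy
    have h0 : 0 ≤ y / η := by positivity
    have h1 : η * ⌊y / η⌋ ≤ y := by
      have := mul_le_mul_of_nonneg_left (Int.floor_le (y / η)) hη.le
      rwa [mul_div_cancel₀ _ hη.ne'] at this
    have h2 : y < η * ⌊y / η⌋ + η := by
      have := mul_lt_mul_of_pos_left (Int.lt_floor_add_one (y / η)) hη
      rw [mul_div_cancel₀ _ hη.ne'] at this
      linarith
    have h3 : (0 : ℤ) ≤ ⌊y / η⌋ := Int.floor_nonneg.2 h0
    have h3' : (0 : ℝ) ≤ ⌊y / η⌋ := by exact_mod_cast h3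
    have h4 : (⌊y / η⌋.natAbs : ℝ) = ⌊y / η⌋ := by
      rw [Nat.cast_natAbs, abs_of_nonneg h3]
    refine ⟨⌊y / η⌋, ?_, ?_, ?_⟩
    · rw [abs_of_nonneg (by linarith)]; linarith
    · rw [abs_of_nonneg (by linarith), abs_of_nonneg hy]
      have := mul_nonneg hη.le h3'
      linarith
    · rw [h4, abs_of_nonneg hy]; exact h1
  rcases le_total 0 x with hx | hx
  · exact key x hx
  · obtain ⟨z, h1, h2, h3⟩ := key (-x) (by linarith)
    have e : x - η * ((-z : ℤ) : ℝ) = -(-x - η * z) := by push_cast; ring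
    refine ⟨-z, ?_, ?_, ?_⟩
    · rwa [e, abs_neg]
    · rw [e, abs_neg]; rwa [abs_neg] at h2
    · rw [Int.natAbs_neg]; rwa [abs_neg] at h3

lemma mul_le_largeSq {τ α : ℝ} (hτ : 0 ≤ τ) (hα : 0 < α) (y r : ℝ) :
    y * r ≤ τ * |r| + α / 2 * largeSq τ y + r ^ 2 / (2 * α) := by
  have h0 : y * r ≤ |y| * |r| := by rw [← abs_mul]; exact le_abs_self _
  have h3 : 0 ≤ r ^ 2 / (2 * α) := by positivity
  unfold largeSq
  split_ifs with h
  · have h1 : α / 2 * y ^ 2 + r ^ 2 / (2 * α) - y * r = (α * y - r) ^ 2 / (2 * α) := by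
      field_simp; ring
    have h2 : 0 ≤ (α * y - r) ^ 2 / (2 * α) := by positivity
    have := mul_nonneg hτ (abs_nonneg r)
    linarith
  · have := mul_le_mul_of_nonneg_right (not_lt.1 h) (abs_nonneg r)
    linarith

lemma sum_abs_residual_le {m n : ℕ} (A : Fin m → Fin n → ℝ) (hm : 0 < m) {τ ε κ : ℝ} (hε : 0 < ε)
    (hτ0 : 0 ≤ τ) (hτ : τ * κ = ε * √m / 2)
    (hA : ∀ T : Finset (Fin m),
      ∑ j, largeSq τ (∑ i, A i j * ((if i ∈ T then 1 else -1) / √m)) ≤ 16 * m)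
    {r : Fin n → ℝ} (hr1 : ∑ j, |r j| ≤ κ) (hr2 : ∑ j, r j ^ 2 ≤ ε ^ 2 / 64) :
    ∑ i, |∑ j, A i j * r j| ≤ ε * m := by
  classical
  set T : Finset (Fin m) := Finset.univ.filter fun i => 0 ≤ ∑ j, A i j * r j with hT
  have hs : 0 < √(m : ℝ) := by positivity
  have hss : √(m : ℝ) * √m = m := Real.mul_self_sqrt (by positivity)
  set y : Fin n → ℝ := fun j => ∑ i, A i j * ((if i ∈ T then 1 else -1) / √m) with hy
  have h1 : ∑ i, |∑ j, A i j * r j| = √m * ∑ j, y j * r j := by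
    calc ∑ i, |∑ j, A i j * r j|
        = ∑ i, ∑ j, √m * (A i j * ((if i ∈ T then 1 else -1) / √m) * r j) := by
          refine Finset.sum_congr rfl fun i _ => ?_
          have : |∑ j, A i j * r j| = (if i ∈ T then 1 else -1) * ∑ j, A i j * r j := by
            by_cases hi : 0 ≤ ∑ j, A i j * r j
            · simp [hT, hi, abs_of_nonneg hi]
            · simp [hT, hi, abs_of_neg (not_le.1 hi)]
          rw [this, Finset.mul_sum]
          refine Finset.sum_congr rfl fun j _ => ?_
          field_simp
      _ = _ := by
          rw [Finset.sum_comm, Finset.mul_sum]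
          refine Finset.sum_congr rfl fun j _ => ?_
          rw [hy, Finset.sum_mul, Finset.mul_sum]
  have hα : 0 < ε / (32 * √m) := by positivity
  have h2 : ∑ j, y j * r j ≤ τ * κ + ε / (32 * √m) / 2 * (16 * m) +
      ε ^ 2 / 64 / (2 * (ε / (32 * √m))) := by
    calc ∑ j, y j * r j ≤ ∑ j, (τ * |r j| + ε / (32 * √m) / 2 * largeSq τ (y j) +
          r j ^ 2 / (2 * (ε / (32 * √m)))) :=
          Finset.sum_le_sum fun j _ => mul_le_largeSq hτ0 hα _ _
      _ = τ * ∑ j, |r j| + ε / (32 * √m) / 2 * ∑ j, largeSq τ (y j) +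
          (∑ j, r j ^ 2) / (2 * (ε / (32 * √m))) := by
          rw [Finset.sum_add_distrib, Finset.sum_add_distrib, Finset.mul_sum, Finset.mul_sum,
            Finset.sum_div]
      _ ≤ _ := by
          gcongr
          exact hA T
  have h3 : ε / (32 * √m) / 2 * (16 * m) = ε * √m / 4 := by
    rw [show 16 * (m : ℝ) = 16 * (√m * √m) by rw [hss]]; field_simp; norm_num
  have h4 : ε ^ 2 / 64 / (2 * (ε / (32 * √m))) = ε * √m / 4 := by
    field_simp; norm_num
  rw [h1]
  calc √m * ∑ j, y j * r j ≤ √m * (ε * √m) := by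
        gcongr; rw [hτ, h3, h4] at h2; linarith
    _ = ε * m := by linear_combination ε * hss

lemma false_of_compressible_null {m n k K : ℕ} (A : Fin m → Fin n → ℝ) (hk : 0 < k) (hm : 0 < m)
    {τ ε η : ℝ} (hε : 0 < ε) (hε1 : ε ≤ 1) (hτ0 : 0 ≤ τ) (hτ : τ * (4 * √k) = ε * √m / 2)
    (hη : η = ε ^ 2 / 256 / √k) (hK : K = ⌊1024 / ε ^ 2 * k⌋₊)
    (hA1 : ∀ T : Finset (Fin m),
      ∑ j, largeSq τ (∑ i, A i j * ((if i ∈ T then 1 else -1) / √m)) ≤ 16 * m)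
    (hA2 : ∀ T : Finset (Fin m), m ≤ 2 * T.card → ∀ z ∈ intBall n K,
      1 / 4 ≤ ∑ j, (η * z j) ^ 2 → ε * m < ∑ i ∈ T, |∑ j, A i j * (η * z j)|)
    {T : Finset (Fin m)} (hT : m ≤ 2 * T.card) {h : Fin n → ℝ}
    (hTh : ∀ i ∈ T, ∑ j, A i j * h j = 0) (h2 : ∑ j, h j ^ 2 = 1) (h1 : ∑ j, |h j| ≤ 4 * √k) :
    False := by
  have hsk : 0 < √(k : ℝ) := by positivity
  have hkk : √(k : ℝ) * √k = k := Real.mul_self_sqrt (by positivity)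
  have hη0 : 0 < η := by rw [hη]; positivity
  choose z hz1 hz2 hz3 using fun j => exists_int_toward_zero hη0 (h j)
  set r : Fin n → ℝ := fun j => h j - η * z j with hr
  have hzK : z ∈ intBall n K := by
    rw [mem_intBall, hK]
    apply Nat.le_floor
    have : η * ∑ j, ((z j).natAbs : ℝ) ≤ 4 * √k := by
      rw [Finset.mul_sum]
      exact (Finset.sum_le_sum fun j _ => hz3 j).trans h1
    push_cast
    rw [← le_div_iff₀' hη0] at this
    refine this.trans (le_of_eq ?_)
    rw [hη, show 1024 / ε ^ 2 * (k : ℝ) = 1024 / ε ^ 2 * (√k * √k) by rw [hkk]]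
    field_simp
    norm_num
  have hr1 : ∑ j, |r j| ≤ 4 * √k := (Finset.sum_le_sum fun j _ => hz2 j).trans h1
  have hr2 : ∑ j, r j ^ 2 ≤ ε ^ 2 / 64 := by
    calc ∑ j, r j ^ 2 ≤ ∑ j, η * |r j| := by
          refine Finset.sum_le_sum fun j _ => ?_
          rw [← sq_abs, sq]
          exact mul_le_mul_of_nonneg_right (hz1 j) (abs_nonneg _)
      _ = η * ∑ j, |r j| := by rw [Finset.mul_sum]
      _ ≤ η * (4 * √k) := by gcongr
      _ = ε ^ 2 / 64 := by rw [hη]; field_simp; norm_num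
  have hz : 1 / 4 ≤ ∑ j, (η * z j) ^ 2 := by
    have : ∑ j, h j ^ 2 ≤ ∑ j, (2 * r j ^ 2 + 2 * (η * z j) ^ 2) := by
      refine Finset.sum_le_sum fun j _ => ?_
      have : h j = r j + η * z j := by simp [hr]
      rw [this]
      nlinarith [sq_nonneg (r j - η * z j)]
    rw [Finset.sum_add_distrib, ← Finset.mul_sum, ← Finset.mul_sum, h2] at this
    have : ε ^ 2 ≤ 1 := pow_le_one₀ hε.le hε1
    linarith
  have hlow := hA2 T hT z hzK hz
  have hup := sum_abs_residual_le A hm hε hτ0 hτ hA1 hr1 hr2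
  have heq : ∑ i ∈ T, |∑ j, A i j * (η * z j)| = ∑ i ∈ T, |∑ j, A i j * r j| := by
    refine Finset.sum_congr rfl fun i hi => ?_
    have : ∑ j, A i j * r j = ∑ j, A i j * h j - ∑ j, A i j * (η * z j) := by
      rw [← Finset.sum_sub_distrib]
      exact Finset.sum_congr rfl fun j _ => by simp only [hr]; ring
    rw [this, hTh i hi, zero_sub, abs_neg]
  have hsub : ∑ i ∈ T, |∑ j, A i j * r j| ≤ ∑ i, |∑ j, A i j * r j| :=
    Finset.sum_le_sum_of_subset_of_nonneg (Finset.subset_univ _) fun _ _ _ => abs_nonneg _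
  linarith

/-- Every vector annihilated by at least half of the rows of `A` has `ℓ₁`-norm at least
`4√k` times its `ℓ₂`-norm. -/
def HalfRowsNullSpread {m n : ℕ} (k : ℕ) (A : Fin m → Fin n → ℝ) : Prop :=
  ∀ T : Finset (Fin m), m ≤ 2 * T.card → ∀ h : Fin n → ℝ, (∀ i ∈ T, ∑ j, A i j * h j = 0) →
    16 * k * ∑ j, h j ^ 2 ≤ (∑ j, |h j|) ^ 2

lemma halfRowsNullSpread_of_events {m n k K : ℕ} (A : Fin m → Fin n → ℝ) (hk : 0 < k) (hm : 0 < m)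
    {τ ε η : ℝ} (hε : 0 < ε) (hε1 : ε ≤ 1) (hτ0 : 0 ≤ τ) (hτ : τ * (4 * √k) = ε * √m / 2)
    (hη : η = ε ^ 2 / 256 / √k) (hK : K = ⌊1024 / ε ^ 2 * k⌋₊)
    (hA1 : ∀ T : Finset (Fin m),
      ∑ j, largeSq τ (∑ i, A i j * ((if i ∈ T then 1 else -1) / √m)) ≤ 16 * m)
    (hA2 : ∀ T : Finset (Fin m), m ≤ 2 * T.card → ∀ z ∈ intBall n K,
      1 / 4 ≤ ∑ j, (η * z j) ^ 2 → ε * m < ∑ i ∈ T, |∑ j, A i j * (η * z j)|) :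
    HalfRowsNullSpread k A := by
  intro T hT h hTh
  by_contra! hlt
  have hkk : √(k : ℝ) ^ 2 = k := Real.sq_sqrt (by positivity)
  set s := √(∑ j, h j ^ 2) with hs
  have hs2 : s ^ 2 = ∑ j, h j ^ 2 := Real.sq_sqrt (Finset.sum_nonneg fun j _ => sq_nonneg _)
  have hs0 : 0 < s := by
    rcases (Real.sqrt_nonneg (∑ j, h j ^ 2)).lt_or_eq with h' | h'
    · exact h'
    · exfalso
      rw [← hs2, hs, ← h'] at hlt
      nlinarith [sq_nonneg (∑ j, |h j|)]
  refine false_of_compressible_null A hk hm hε hε1 hτ0 hτ hη hK hA1 hA2 hT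
    (h := fun j => h j / s) (fun i hi => ?_) ?_ ?_
  · simp_rw [← mul_div_assoc]
    rw [← Finset.sum_div, hTh i hi, zero_div]
  · simp_rw [div_pow]
    rw [← Finset.sum_div, ← hs2, div_self (by positivity)]
  · simp_rw [abs_div, abs_of_pos hs0]
    rw [← Finset.sum_div, div_le_iff₀ hs0]
    refine abs_le_of_sq_le_sq' ?_ (by positivity) |>.2
    rw [mul_pow, mul_pow, hkk, hs2]
    linarith

end NullSpace

section Recovery

lemma lpNorm_one_eq {n : ℕ} (x : Fin n → ℝ) : _root_.lpNorm 1 x = ∑ j, |x j| := by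
  simp [_root_.lpNorm]

lemma lpNorm_two_eq {n : ℕ} (x : Fin n → ℝ) : _root_.lpNorm 2 x = √(∑ j, x j ^ 2) := by
  simp [_root_.lpNorm, Real.sqrt_eq_rpow]

lemma phaseDist_le {n : ℕ} (q : ℝ) (x y : Fin n → ℝ) {c : ℝ} (hc : |c| = 1) :
    phaseDist q x y ≤ _root_.lpNorm q (fun i => x i - c * y i) := by
  refine csInf_le ⟨0, ?_⟩ ⟨c, hc, rfl⟩
  rintro d ⟨c, -, rfl⟩
  exact Real.rpow_nonneg (Finset.sum_nonneg fun i _ => Real.rpow_nonneg (norm_nonneg _) _) _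

lemma sum_abs_sub_le_of_spread {n k : ℕ} {x xs z : Fin n → ℝ} (hz : l0Norm z ≤ k)
    (hle : ∑ j, |xs j| ≤ ∑ j, |x j|)
    (hsp : 16 * k * ∑ j, (xs j - x j) ^ 2 ≤ (∑ j, |xs j - x j|) ^ 2) :
    ∑ j, |xs j - x j| ≤ 4 * ∑ j, |x j - z j| := by
  classical
  set S : Finset (Fin n) := Finset.univ.filter fun j => z j ≠ 0 with hS
  have hSk : (S.card : ℝ) ≤ k := by
    have : S.card = l0Norm z := by unfold l0Norm; congr
    rw [this]; exact_mod_cast hz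
  have h1 : ∑ j ∈ S, |xs j - x j| ≤ (∑ j, |xs j - x j|) / 4 := by
    have hnn : 0 ≤ ∑ j, |xs j - x j| := Finset.sum_nonneg fun j _ => abs_nonneg _
    refine abs_le_of_sq_le_sq' ?_ (by positivity) |>.2
    have hcs := sq_sum_le_card_mul_sum_sq (s := S) (f := fun j => |xs j - x j|)
    simp only [sq_abs] at hcs
    have h2 : ∑ j ∈ S, (xs j - x j) ^ 2 ≤ ∑ j, (xs j - x j) ^ 2 :=
      Finset.sum_le_sum_of_subset_of_nonneg (Finset.subset_univ _) fun _ _ _ => sq_nonneg _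
    have h3 : (S.card : ℝ) * ∑ j ∈ S, (xs j - x j) ^ 2 ≤ k * ∑ j, (xs j - x j) ^ 2 :=
      mul_le_mul hSk h2 (Finset.sum_nonneg fun _ _ => sq_nonneg _) (by positivity)
    rw [div_pow]
    linarith
  have h2 : ∑ j, (|x j| + |xs j - x j| - 2 * (if j ∈ S then |xs j - x j| else 0) -
      2 * |x j - z j|) ≤ ∑ j, |xs j| := by
    refine Finset.sum_le_sum fun j _ => ?_
    have e1 := abs_sub_abs_le_abs_sub (x j) (xs j)
    have e2 := abs_sub (xs j) (x j)
    rw [abs_sub_comm] at e1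
    split_ifs with hj
    · linarith [abs_nonneg (x j - z j)]
    · have : z j = 0 := by simpa [hS] using hj
      rw [this, sub_zero]
      linarith
  rw [Finset.sum_sub_distrib, Finset.sum_sub_distrib, Finset.sum_add_distrib, ← Finset.mul_sum,
    ← Finset.mul_sum, Finset.sum_ite_mem, Finset.univ_inter] at h2
  linarith

lemma recovery_of_spread {m n k : ℕ} (hk : 0 < k) {A : Fin m → Fin n → ℝ}
    (hA : HalfRowsNullSpread k A) {x xs : Fin n → ℝ}
    (hAx : ∀ i, absMv A xs i = absMv A x i) (hle : ∑ j, |xs j| ≤ ∑ j, |x j|) :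
    phaseDist 1 xs x ≤ 4 * sigmaK k 1 x ∧
      phaseDist 2 xs x ≤ 4 * sigmaK k 1 x / √k := by
  classical
  have hAx' : ∀ i, ∑ j, A i j * xs j = ∑ j, A i j * x j ∨
      ∑ j, A i j * xs j = -∑ j, A i j * x j := fun i => abs_eq_abs.1 (hAx i)
  obtain ⟨c, hc, T, hT, hTc⟩ : ∃ c : ℝ, |c| = 1 ∧ ∃ T : Finset (Fin m), m ≤ 2 * T.card ∧
      ∀ i ∈ T, ∑ j, A i j * (xs j - c * x j) = 0 := by
    set T : Finset (Fin m) :=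
      Finset.univ.filter fun i => ∑ j, A i j * xs j = ∑ j, A i j * x j with hT
    have hcard : T.card + Tᶜ.card = m := by rw [Finset.card_add_card_compl, Fintype.card_fin]
    have hlin : ∀ (c : ℝ) i, ∑ j, A i j * (xs j - c * x j) =
        ∑ j, A i j * xs j - c * ∑ j, A i j * x j := by
      intro c i
      rw [Finset.mul_sum, ← Finset.sum_sub_distrib]
      exact Finset.sum_congr rfl fun j _ => by ring
    rcases le_total m (2 * T.card) with h | h
    · refine ⟨1, by simp, T, h, fun i hi => ?_⟩
      rw [hlin, (Finset.mem_filter.1 hi).2]; ring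
    · refine ⟨-1, by simp, Tᶜ, by omega, fun i hi => ?_⟩
      have hne : ¬ ∑ j, A i j * xs j = ∑ j, A i j * x j := by simpa [hT] using hi
      rw [hlin, (hAx' i).resolve_left hne]; ring
  have hsp := hA T hT _ hTc
  have hcx : ∀ y : Fin n → ℝ, ∑ j, |c * y j| = ∑ j, |y j| := by simp [abs_mul, hc]
  have hl1 : (∑ j, |xs j - c * x j|) / 4 ≤ sigmaK k 1 x := by
    refine le_csInf ⟨_, 0, by simp [l0Norm], rfl⟩ ?_
    rintro d ⟨z, hz, rfl⟩
    rw [lpNorm_one_eq, ← hcx (fun i => x i - z i)]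
    have hcz : l0Norm (fun j => c * z j) ≤ k := by
      refine le_trans (Finset.card_le_card fun j => ?_) hz
      simp +contextual
    have := sum_abs_sub_le_of_spread (x := fun j => c * x j) hcz (by rwa [hcx]) hsp
    simp_rw [mul_sub]
    linarith
  have hsk : 0 < √(k : ℝ) := by positivity
  refine ⟨(phaseDist_le 1 xs x hc).trans ?_, (phaseDist_le 2 xs x hc).trans ?_⟩
  · rw [lpNorm_one_eq]; linarith
  · rw [lpNorm_two_eq]
    have hnn : 0 ≤ ∑ j, |xs j - c * x j| := Finset.sum_nonneg fun j _ => abs_nonneg _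
    rw [le_div_iff₀ hsk, ← Real.sqrt_mul (Finset.sum_nonneg fun _ _ => sq_nonneg _)]
    have : √((∑ j, (xs j - c * x j) ^ 2) * k) ≤ (∑ j, |xs j - c * x j|) / 4 := by
      rw [Real.sqrt_le_left (by positivity), div_pow]
      linarith
    linarith

end Recovery

section Probability

lemma two_le_exp_one : (2 : ℝ) ≤ exp 1 := by
  have := add_one_le_exp (1 : ℝ); linarith

lemma two_pow_le_exp (m : ℕ) : (2 : ℝ) ^ m ≤ exp m := by
  rw [← Real.exp_one_pow]
  exact pow_le_pow_left₀ (by norm_num) two_le_exp_one m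

lemma card_finset_fin_le_exp (m : ℕ) : (Fintype.card (Finset (Fin m)) : ℝ) ≤ exp m := by
  rw [Fintype.card_finset, Fintype.card_fin]
  push_cast
  exact two_pow_le_exp m

lemma one_le_log_mul_div {k n : ℕ} (hk : 0 < k) (hkn : k ≤ n) :
    1 ≤ Real.log (Real.exp 1 * n / k) := by
  have hk' : (0 : ℝ) < k := by exact_mod_cast hk
  have hn' : (k : ℝ) ≤ n := by exact_mod_cast hkn
  have hn : (0 : ℝ) < n := hk'.trans_le hn'
  rw [Real.le_log_iff_exp_le (by positivity), mul_div_assoc]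
  exact le_mul_of_one_le_right (exp_pos _).le ((one_le_div hk').2 hn')

lemma exp_neg_log_mul_div {k n : ℕ} (hk : 0 < k) (hkn : k ≤ n) :
    n * exp (-Real.log (Real.exp 1 * n / k)) ≤ k / 2 := by
  have hk' : (0 : ℝ) < k := by exact_mod_cast hk
  have hn' : (0 : ℝ) < n := by exact_mod_cast hk.trans_le hkn
  rw [exp_neg, exp_log (by positivity), inv_div, mul_div_assoc', mul_comm, mul_div_mul_right _ _ hn'.ne']
  gcongr
  exact two_le_exp_one

lemma measure_iUnion_largeSq_le {k n m : ℕ} (hk : 0 < k) (hkn : k ≤ n) (hkm : (k : ℝ) ≤ m) {τ : ℝ}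
    (hτ0 : 0 ≤ τ) (hτ : Real.log (Real.exp 1 * n / k) ≤ τ ^ 2 / 8) :
    gaussMatrixReal m n (⋃ T : Finset (Fin m),
      {A | 16 * m ≤ ∑ j, largeSq τ (∑ i, A i j * ((if i ∈ T then 1 else -1) / √m))}) ≤
      ENNReal.ofReal (exp (-2 * m)) := by
  have hk' : (0 : ℝ) < k := by exact_mod_cast hk
  have hm : (0 : ℝ) < m := hk'.trans_le hkm
  have hT : ∀ T : Finset (Fin m), gaussMatrixReal m n
      {A | 16 * m ≤ ∑ j, largeSq τ (∑ i, A i j * ((if i ∈ T then 1 else -1) / √m))} ≤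
      ENNReal.ofReal (exp (-3 * m)) := by
    intro T
    have hw : ∑ i : Fin m, ((if i ∈ T then (1 : ℝ) else -1) / √m) ^ 2 = 1 := by
      have : ∀ i : Fin m, ((if i ∈ T then (1 : ℝ) else -1) / √m) ^ 2 = 1 / m := by
        intro i
        rw [div_pow, Real.sq_sqrt hm.le]
        split_ifs <;> norm_num
      simp [this, hm.ne']
    refine (gaussMatrix_largeSq_tail hw hτ0 _).trans (ENNReal.ofReal_le_ofReal ?_)
    rw [← exp_add, exp_le_exp]
    have h1 : n * exp (-(τ ^ 2 / 8)) ≤ n * exp (-Real.log (Real.exp 1 * n / k)) := by gcongr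
    have h2 := exp_neg_log_mul_div hk hkn
    linarith
  refine (measure_iUnion_le _).trans ?_
  rw [tsum_fintype]
  refine (Finset.sum_le_sum fun T _ => hT T).trans ?_
  rw [Finset.sum_const, nsmul_eq_mul, Finset.card_univ, ← ENNReal.ofReal_natCast,
    ← ENNReal.ofReal_mul (by positivity)]
  refine ENNReal.ofReal_le_ofReal ?_
  calc _ ≤ exp m * exp (-3 * m) := by gcongr; exact card_finset_fin_le_exp m
    _ = exp (-2 * m) := by rw [← exp_add]; ring_nf

lemma card_intBall_le_exp {k n K : ℕ} (hk : 0 < k) (hkn : k ≤ n) {b : ℝ} (hK : K ≤ b * k) :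
    ((intBall n K).card : ℝ) ≤ exp ((b + 2) * k * Real.log (Real.exp 1 * n / k)) := by
  have hk' : (0 : ℝ) < k := by exact_mod_cast hk
  have hn' : (0 : ℝ) < n := by exact_mod_cast hk.trans_le hkn
  have hkn' : (k : ℝ) ≤ n := by exact_mod_cast hkn
  have hL := one_le_log_mul_div hk hkn
  set L := Real.log (Real.exp 1 * n / k) with hLdef
  have h2 := two_le_exp_one
  have ht : (k : ℝ) / (exp 1 * n) ≤ 1 / 2 := by
    rw [div_le_div_iff₀ (by positivity) (by norm_num)]
    nlinarith
  refine (card_intBall_le (by positivity) ht n K).trans ?_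
  have h3 : 1 / ((k : ℝ) / (exp 1 * n)) = exp L := by
    rw [hLdef, exp_log (by positivity), one_div_div]
  rw [h3, ← exp_nat_mul, ← exp_add, exp_le_exp]
  have h4 : n * (4 * (k / (exp 1 * n))) ≤ 2 * (k : ℝ) := by
    have : n * (4 * (k / (exp 1 * n))) = 4 * k / exp 1 := by field_simp
    rw [this, div_le_iff₀ (exp_pos _)]
    nlinarith
  nlinarith [mul_le_mul_of_nonneg_right hK (zero_le_one.trans hL)]

lemma measure_biUnion_small_ball_le {k n m K : ℕ} (hk : 0 < k) (hkn : k ≤ n) {ε η b : ℝ}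
    (hε : ε = exp (-11)) (hK : K ≤ b * k)
    (hm : (b + 2) * k * Real.log (Real.exp 1 * n / k) ≤ m) :
    gaussMatrixReal m n (⋃ p ∈ (Finset.univ ×ˢ intBall n K).filter
        fun p : Finset (Fin m) × (Fin n → ℤ) =>
          m ≤ 2 * p.1.card ∧ 1 / 4 ≤ ∑ j, (η * p.2 j) ^ 2,
      {A | ∑ i ∈ p.1, |∑ j, A i j * (η * p.2 j)| ≤ ε * m}) ≤
      ENNReal.ofReal (exp (-2 * m)) := by
  have hε0 : 0 < ε := hε ▸ exp_pos _
  refine (measure_biUnion_finset_le _ _).trans ?_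
  refine (Finset.sum_le_sum (g := fun _ => ENNReal.ofReal (exp (-4 * m))) fun p hp => ?_).trans ?_
  · obtain ⟨-, hT, hz⟩ := Finset.mem_filter.1 hp
    refine (gaussMatrix_small_ball hz p.1 (inv_pos.2 hε0) _).trans (ENNReal.ofReal_le_ofReal ?_)
    have h1 : 2 / ε⁻¹ ≤ exp (-10) := by
      rw [div_inv_eq_mul, hε]
      calc 2 * exp (-11) ≤ exp 1 * exp (-11) := by gcongr; exact two_le_exp_one
        _ = exp (-10) := by rw [← exp_add]; norm_num
    have h2 : (m : ℝ) ≤ 2 * p.1.card := by exact_mod_cast hT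
    calc exp (ε⁻¹ * (ε * m)) * (2 / ε⁻¹) ^ p.1.card
        ≤ exp (ε⁻¹ * (ε * m)) * exp (-10) ^ p.1.card := by gcongr
      _ = exp (m + p.1.card * (-10)) := by
          rw [← exp_nat_mul, ← exp_add, inv_mul_cancel_left₀ hε0.ne']
      _ ≤ exp (-4 * m) := exp_le_exp.2 (by linarith)
  · rw [Finset.sum_const, nsmul_eq_mul, ← ENNReal.ofReal_natCast,
      ← ENNReal.ofReal_mul (by positivity)]
    refine ENNReal.ofReal_le_ofReal ?_
    have hcard : (((Finset.univ ×ˢ intBall n K).filter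
        fun p : Finset (Fin m) × (Fin n → ℤ) =>
          m ≤ 2 * p.1.card ∧ 1 / 4 ≤ ∑ j, (η * p.2 j) ^ 2).card : ℝ) ≤ exp m * exp m := by
      refine (Nat.cast_le.2 (Finset.card_filter_le _ _)).trans ?_
      rw [Finset.card_product, Nat.cast_mul, Finset.card_univ]
      gcongr
      · exact card_finset_fin_le_exp m
      · exact (card_intBall_le_exp hk hkn hK).trans (exp_le_exp.2 hm)
    calc _ ≤ exp m * exp m * exp (-4 * m) := by gcongr
      _ = exp (-2 * m) := by rw [← exp_add, ← exp_add]; ring_nf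

lemma gaussMatrix_halfRowsNullSpread {k n m : ℕ} (hk : 0 < k) (hkn : k ≤ n)
    (hm : 2000 / exp (-11) ^ 2 * k * Real.log (Real.exp 1 * n / k) ≤ m) :
    gaussMatrixReal m n {A | HalfRowsNullSpread k A}ᶜ ≤ ENNReal.ofReal (exp (-m)) := by
  have hε0 : 0 < exp (-11) := exp_pos _
  have hε1 : exp (-11) ≤ 1 := exp_le_one_iff.2 (by norm_num)
  generalize hε : exp (-11) = ε at *
  have hk' : (1 : ℝ) ≤ k := by exact_mod_cast hk
  have hk0 : (0 : ℝ) < k := by linarith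
  have hL := one_le_log_mul_div hk hkn
  have hε2 : 1 ≤ 1 / ε ^ 2 := by
    rw [one_le_div (by positivity)]; exact pow_le_one₀ hε0.le hε1
  have hmk : 2000 * (1 / ε ^ 2) * (k * Real.log (Real.exp 1 * n / k)) ≤ m := by
    convert hm using 1; ring
  generalize hLe : Real.log (Real.exp 1 * n / k) = L at *
  have hkL : (k : ℝ) ≤ k * L := le_mul_of_one_le_right hk0.le hL
  have hkm : (k : ℝ) ≤ m := by nlinarith
  have hm1 : (1 : ℝ) ≤ m := hk'.trans hkm
  have hm0 : 0 < m := by exact_mod_cast zero_lt_one.trans_le hm1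
  have hsk : 0 < √(k : ℝ) := by positivity
  set τ := ε * √m / (8 * √k) with hτ
  have hτ0 : 0 ≤ τ := by positivity
  have hτL : L ≤ τ ^ 2 / 8 := by
    have : τ ^ 2 / 8 = ε ^ 2 * m / (512 * k) := by
      rw [hτ, div_pow, mul_pow, mul_pow, Real.sq_sqrt (by positivity), Real.sq_sqrt (by positivity)]
      field_simp
      norm_num
    rw [this, le_div_iff₀ (by positivity)]
    have h := mul_le_mul_of_nonneg_left hmk (sq_nonneg ε)
    have e : ε ^ 2 * (2000 * (1 / ε ^ 2) * (k * L)) = 2000 * (k * L) := by field_simp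
    rw [e] at h
    nlinarith
  set η := ε ^ 2 / 256 / √k with hη
  set K := ⌊1024 / ε ^ 2 * k⌋₊ with hK
  have hKb : (K : ℝ) ≤ 1024 / ε ^ 2 * k := Nat.floor_le (by positivity)
  have hm2 : (1024 / ε ^ 2 + 2) * k * L ≤ m := by
    refine le_trans ?_ hmk
    have : (1024 / ε ^ 2 + 2) * k * L = (1024 * (1 / ε ^ 2) + 2) * (k * L) := by ring
    rw [this]
    gcongr
    linarith
  have hE1 := measure_iUnion_largeSq_le hk hkn hkm hτ0 (hLe.symm ▸ hτL)
  have hE2 := measure_biUnion_small_ball_le (η := η) hk hkn hε.symm hKb (hLe.symm ▸ hm2)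
  refine (measure_mono (fun A hA => ?_)).trans ((measure_union_le _ _).trans
    ((add_le_add hE1 hE2).trans ?_))
  · by_contra hbad
    simp only [Set.mem_union, Set.mem_iUnion, Set.mem_ofPred_eq, not_or, not_exists, not_le,
      Finset.mem_filter, Finset.mem_product, Finset.mem_univ, true_and] at hbad
    refine hA (halfRowsNullSpread_of_events A hk hm0 hε0 hε1 hτ0 ?_ hη hK
      (fun T => (hbad.1 T).le) fun T hT z hz hzη => hbad.2 (T, z) ⟨hz, hT, hzη⟩)
    rw [hτ]; field_simp; norm_num
  · rw [← ENNReal.ofReal_add (exp_pos _).le (exp_pos _).le]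
    refine ENNReal.ofReal_le_ofReal ?_
    have h1 : exp (-2 * m) = exp (-m) * exp (-m) := by rw [← exp_add]; ring_nf
    have h2 : exp (-(m : ℝ)) * 2 ≤ 1 := by
      rw [exp_neg, inv_mul_le_iff₀ (exp_pos _), mul_one]
      exact two_le_exp_one.trans (exp_le_exp.2 hm1)
    rw [h1]
    nlinarith [exp_pos (-(m : ℝ))]

end Probability

/-- Corollary `(2,1) and (1,1)`, real case: for a standard Gaussian random
matrix `A ∈ ℝ^{m×n}` with `m ≥ C₀·k·log(en/k)`, with probability at least `1 - exp(-c₀ m)`,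
every `ℓ₁` minimizer `x♯` subject to `|Ax♯| = |Ax|` satisfies
`dist₁(x♯,x) ≤ C·σ_k(x)₁` and `dist(x♯,x) ≤ C·σ_k(x)₁/√k`. -/
theorem stmt9 :
    ∃ C₀ c₀ C : ℝ, 0 < C₀ ∧ 0 < c₀ ∧ 0 < C ∧
      ∀ k n m : ℕ, 0 < k → k ≤ n →
        C₀ * k * Real.log (Real.exp 1 * n / k) ≤ m →
        ENNReal.ofReal (1 - Real.exp (-c₀ * m)) ≤
          gaussMatrixReal m n
            {A : Fin m → Fin n → ℝ | ∀ x xs : Fin n → ℝ,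
              (∀ i, absMv A xs i = absMv A x i) →
              (∀ z : Fin n → ℝ, (∀ i, absMv A z i = absMv A x i) → lpNorm 1 xs ≤ lpNorm 1 z) →
              phaseDist 1 xs x ≤ C * sigmaK k 1 x ∧
              phaseDist 2 xs x ≤ C * sigmaK k 1 x / Real.sqrt k} := by
  refine ⟨2000 / exp (-11) ^ 2, 1, 4, by positivity, one_pos, by norm_num,
    fun k n m hk hkn hm => ?_⟩
  set S : Set (Fin m → Fin n → ℝ) := {A | HalfRowsNullSpread k A}
  have hS : 1 ≤ gaussMatrixReal m n S + ENNReal.ofReal (exp (-m)) := by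
    calc (1 : ENNReal) = gaussMatrixReal m n (S ∪ Sᶜ) := by simp
      _ ≤ gaussMatrixReal m n S + gaussMatrixReal m n Sᶜ := measure_union_le _ _
      _ ≤ _ := by gcongr; exact gaussMatrix_halfRowsNullSpread hk hkn hm
  have hle : ENNReal.ofReal (1 - exp (-1 * m)) ≤ gaussMatrixReal m n S := by
    rw [neg_one_mul, ENNReal.ofReal_sub _ (exp_pos _).le, ENNReal.ofReal_one]
    exact tsub_le_iff_right.2 hS
  refine hle.trans (measure_mono fun A hA x xs hAx hmin => ?_)
  have h1 := hmin x fun _ => rfl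
  rw [lpNorm_one_eq, lpNorm_one_eq] at h1
  exact recovery_of_spread hk hA hAx h1
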